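/- Let M̄ be the commutative monoid presented by generators x̄0, ȳ0, z̄0, x̄1, x̄2, ... and relations x̄0 + ȳ0 = x̄0 + z̄0 and x̄_l = x̄_{l+1} + ȳ0 = x̄_{l+1} + z̄0 for all l ≥ 0. Then M̄ is a wild refinement monoid (a refinement monoid that is not tame), and M̄ is conical, stably finite, antisymmetric, separative, and unperforated, but not archimedean. -/

import Mathlib

/-- A commutative monoid satisfies the Riesz refinement property if every equation
`x1 + x2 = y1 + y2` admits a refinement matrix. -/
def IsRefinementAddMonoid (M : Type*) [AddCommMonoid M] : Prop :=
  ∀ x1 x2 y1 y2 : M, x1 + x2 = y1 + y2 →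
    ∃ z11 z12 z21 z22 : M,
      x1 = z11 + z12 ∧ x2 = z21 + z22 ∧ y1 = z11 + z21 ∧ y2 = z12 + z22

/-- The algebraic (minimal) ordering on a commutative monoid: `x ≤ y` iff `x + z = y`
for some `z`. -/
def AlgLE {M : Type*} [AddCommMonoid M] (x y : M) : Prop := ∃ z, x + z = y

/-- A commutative monoid is conical if `x + y = 0` implies `x = y = 0`. -/
def IsConical (M : Type*) [AddCommMonoid M] : Prop :=
  ∀ x y : M, x + y = 0 → x = 0 ∧ y = 0

/-- Stably finite: `x + y = x` implies `y = 0`. -/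
def IsStablyFinite (M : Type*) [AddCommMonoid M] : Prop :=
  ∀ x y : M, x + y = x → y = 0

/-- Separative: `2x = 2y = x + y` implies `x = y`. -/
def IsSeparative (M : Type*) [AddCommMonoid M] : Prop :=
  ∀ x y : M, x + x = y + y → x + x = x + y → x = y

/-- Cancellative: `x + y = x + z` implies `y = z`. -/
def IsCancellative (M : Type*) [AddCommMonoid M] : Prop :=
  ∀ x y z : M, x + y = x + z → y = z

/-- Unperforated: `m x ≤ m y` implies `x ≤ y` (algebraic order), for positive `m`. -/
def IsUnperforated (M : Type*) [AddCommMonoid M] : Prop :=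
  ∀ (m : ℕ) (x y : M), 0 < m → AlgLE (m • x) (m • y) → AlgLE x y

/-- Antisymmetric: the algebraic ordering is antisymmetric. -/
def IsAntisymmetricMon (M : Type*) [AddCommMonoid M] : Prop :=
  ∀ x y : M, AlgLE x y → AlgLE y x → x = y

/-- Archimedean: if `n x ≤ y` for all positive `n`, then `x` is invertible. -/
def IsArchimedeanMon (M : Type*) [AddCommMonoid M] : Prop :=
  ∀ x y : M, (∀ n : ℕ, 0 < n → AlgLE (n • x) y) → IsAddUnit x

/-- Riesz interpolation property. -/
def HasRieszInterpolation (M : Type*) [AddCommMonoid M] : Prop :=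
  ∀ x1 x2 y1 y2 : M, AlgLE x1 y1 → AlgLE x1 y2 → AlgLE x2 y1 → AlgLE x2 y2 →
    ∃ z : M, AlgLE x1 z ∧ AlgLE x2 z ∧ AlgLE z y1 ∧ AlgLE z y2

/-- An element is irreducible if it is not invertible and whenever `x = a + b`,
either `a` or `b` is invertible. -/
def IsIrreducibleElem {M : Type*} [AddCommMonoid M] (x : M) : Prop :=
  ¬ IsAddUnit x ∧ ∀ a b : M, x = a + b → IsAddUnit a ∨ IsAddUnit b

/-- A witness that the inclusion of the submonoid `S` into `M` factors through a
finitely generated refinement monoid. -/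
structure TameWitness (M : Type*) [AddCommMonoid M] (S : AddSubmonoid M) where
  N : Type
  [instN : AddCommMonoid N]
  fg : AddMonoid.FG N
  refinement : IsRefinementAddMonoid N
  f : ↥S →+ N
  g : N →+ M
  factors : ∀ s : ↥S, g (f s) = (s : M)

/-- A (refinement) monoid is tame if for each finitely generated submonoid `S ⊆ M`, the
inclusion map `S → M` factors through a finitely generated refinement monoid. -/
def IsTame (M : Type*) [AddCommMonoid M] : Prop :=
  ∀ S : AddSubmonoid M, S.FG → Nonempty (TameWitness M S)

/-- Generators of the free commutative monoid underlying the monoid `M̄`: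
`Sum.inl l` is `x̄_l` (for `l ≥ 0`), `Sum.inr 0` is `ȳ0` and `Sum.inr 1` is `z̄0`. -/
abbrev FreeGenMb : Type := ℕ ⊕ Fin 2

/-- The free commutative monoid on the generators. -/
abbrev FreeMonMb : Type := FreeGenMb →₀ ℕ

/-- The generator `x̄_l`. -/
noncomputable def Xbg (l : ℕ) : FreeMonMb := Finsupp.single (Sum.inl l) 1
/-- The generator `ȳ0`. -/
noncomputable def Ybg : FreeMonMb := Finsupp.single (Sum.inr 0) 1
/-- The generator `z̄0`. -/
noncomputable def Zbg : FreeMonMb := Finsupp.single (Sum.inr 1) 1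

/-- The defining relations: `x̄0 + ȳ0 = x̄0 + z̄0`, `x̄_l = x̄_{l+1} + ȳ0`, and
`x̄_l = x̄_{l+1} + z̄0`. -/
def MbRel : FreeMonMb → FreeMonMb → Prop := fun u v =>
  (u = Xbg 0 + Ybg ∧ v = Xbg 0 + Zbg) ∨
  (∃ l, u = Xbg l ∧ v = Xbg (l + 1) + Ybg) ∨
  (∃ l, u = Xbg l ∧ v = Xbg (l + 1) + Zbg)

/-- The smallest congruence containing the defining relations. -/
noncomputable def MbCon : AddCon FreeMonMb := addConGen MbRel

/-- The monoid `M̄` of Section 4 of the paper. -/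
abbrev MonMb : Type := MbCon.Quotient

/-- Concrete model: `lo a b` is `a y + b z`; `hi n k` is `(n+1) x_0 + k y`. -/
inductive MbModel : Type
  | lo : ℕ → ℕ → MbModel
  | hi : ℕ → ℤ → MbModel

set_option linter.unusedSimpArgs false

namespace MbModel

/-- Addition on the model. -/
def plus : MbModel → MbModel → MbModel
  | lo a b, lo c d => lo (a + c) (b + d)
  | lo a b, hi n k => hi n (k + a + b)
  | hi n k, lo a b => hi n (k + a + b)
  | hi n k, hi m l => hi (n + m + 1) (k + l)

instance : Add MbModel := ⟨plus⟩
instance : Zero MbModel := ⟨lo 0 0⟩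

theorem zero_def : (0 : MbModel) = lo 0 0 := rfl
theorem ll (a b c d : ℕ) : lo a b + lo c d = lo (a + c) (b + d) := rfl
theorem lh (a b n : ℕ) (k : ℤ) : lo a b + hi n k = hi n (k + a + b) := rfl
theorem hl (a b n : ℕ) (k : ℤ) : hi n k + lo a b = hi n (k + a + b) := rfl
theorem hh (n m : ℕ) (k l : ℤ) : hi n k + hi m l = hi (n + m + 1) (k + l) := rfl

instance : AddCommMonoid MbModel where
  add_assoc := by
    rintro (⟨a, b⟩ | ⟨a, b⟩) (⟨c, d⟩ | ⟨c, d⟩) (⟨e, f⟩ | ⟨e, f⟩) <;>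
      simp only [ll, lh, hl, hh, lo.injEq, hi.injEq] <;> constructor <;> (try push_cast) <;> omega
  zero_add := by
    rintro (⟨a, b⟩ | ⟨a, b⟩) <;> simp [zero_def, ll, lh]
  add_zero := by
    rintro (⟨a, b⟩ | ⟨a, b⟩) <;> simp [zero_def, ll, hl]
  add_comm := by
    rintro (⟨a, b⟩ | ⟨a, b⟩) (⟨c, d⟩ | ⟨c, d⟩) <;>
      simp only [ll, lh, hl, hh, lo.injEq, hi.injEq] <;> constructor <;> omega
  nsmul := nsmulRec

theorem nsmul_lo (m a b : ℕ) : m • lo a b = lo (m * a) (m * b) := by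
  induction m with
  | zero => simp [zero_def]
  | succ m ih => rw [succ_nsmul, ih, ll]; congr 1 <;> ring

theorem nsmul_hi (m n : ℕ) (k : ℤ) :
    (m + 1) • hi n k = hi ((m + 1) * n + m) ((m + 1) * k) := by
  induction m with
  | zero => simp
  | succ m ih => rw [succ_nsmul, ih, hh]; congr 1 <;> push_cast <;> ring

theorem refinement : IsRefinementAddMonoid MbModel := by
  rintro (⟨a, b⟩ | ⟨n, k⟩) (⟨c, d⟩ | ⟨m, l⟩) (⟨a', b'⟩ | ⟨n', k'⟩) (⟨c', d'⟩ | ⟨m', l'⟩) h <;>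
    simp only [ll, lh, hl, hh, lo.injEq, hi.injEq, reduceCtorEq] at h
  · refine ⟨lo (min a a') (min b b'), lo (a - min a a') (b - min b b'),
      lo (a' - min a a') (b' - min b b'), lo (c - (a' - min a a')) (d - (b' - min b b')), ?_⟩
    simp only [ll, lo.injEq, true_and, and_true]; omega
  · refine ⟨lo 0 0, lo a b, lo a' b', hi m (l - a' - b'), ?_⟩
    simp only [ll, lh, hl, lo.injEq, hi.injEq, true_and, and_true]; omega
  · refine ⟨lo a b, lo 0 0, hi m (l - c' - d'), lo c' d', ?_⟩
    simp only [ll, lh, hl, lo.injEq, hi.injEq, true_and, and_true]; omega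
  · refine ⟨lo a b, lo 0 0, hi n' (k' - a - b), hi m' l', ?_⟩
    simp only [ll, lh, hl, hh, lo.injEq, hi.injEq, true_and, and_true]; omega
  · refine ⟨lo a' b', hi n (k - a' - b'), lo 0 0, lo c d, ?_⟩
    simp only [ll, lh, hl, lo.injEq, hi.injEq, true_and, and_true]; omega
  · refine ⟨hi n (k - c' - d'), lo c' d', lo c d, lo 0 0, ?_⟩
    simp only [ll, lh, hl, lo.injEq, hi.injEq, true_and, and_true]; omega
  · refine ⟨hi n' k', hi m' (l' - c - d), lo 0 0, lo c d, ?_⟩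
    simp only [ll, lh, hl, hh, lo.injEq, hi.injEq, true_and, and_true]; omega
  · refine ⟨lo a' b', hi n (k - a' - b'), lo 0 0, hi m l, ?_⟩
    simp only [ll, lh, hl, hh, lo.injEq, hi.injEq, true_and, and_true]; omega
  · refine ⟨hi n (k - c' - d'), lo c' d', hi m l, lo 0 0, ?_⟩
    simp only [ll, lh, hl, hh, lo.injEq, hi.injEq, true_and, and_true]; omega
  · rcases lt_trichotomy n n' with hn | hn | hn
    · refine ⟨hi n k, lo 0 0, hi (n' - n - 1) (k' - k), hi m' l', ?_⟩
      simp only [ll, lh, hl, hh, lo.injEq, hi.injEq, true_and, and_true]; omega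
    · refine ⟨hi n (k - (k - k').toNat), lo (k - k').toNat 0, lo (k' - k).toNat 0,
        hi m (l - (k' - k).toNat), ?_⟩
      simp only [ll, lh, hl, hh, lo.injEq, hi.injEq, true_and, and_true]; omega
    · refine ⟨hi n' k', hi (n - n' - 1) (k - k'), lo 0 0, hi m l, ?_⟩
      simp only [ll, lh, hl, hh, lo.injEq, hi.injEq, true_and, and_true]; omega

theorem conical : IsConical MbModel := by
  rintro (⟨a, b⟩ | ⟨n, k⟩) (⟨c, d⟩ | ⟨m, l⟩) h <;>
    simp only [ll, lh, hl, hh, zero_def, lo.injEq, hi.injEq, reduceCtorEq] at h ⊢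
  omega

theorem stablyFinite : IsStablyFinite MbModel := by
  rintro (⟨a, b⟩ | ⟨n, k⟩) (⟨c, d⟩ | ⟨m, l⟩) h <;>
    simp only [ll, lh, hl, hh, zero_def, lo.injEq, hi.injEq, reduceCtorEq] at h ⊢ <;> omega

theorem antisymm : IsAntisymmetricMon MbModel := by
  rintro x y ⟨s, hs⟩ ⟨t, ht⟩
  have h : x + (s + t) = x := by rw [← add_assoc, hs, ht]
  have h2 := (conical s t (stablyFinite _ _ h)).1
  rw [← hs, h2, add_zero]

theorem separative : IsSeparative MbModel := by
  rintro (⟨a, b⟩ | ⟨n, k⟩) (⟨c, d⟩ | ⟨m, l⟩) h _ <;>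
    simp only [ll, lh, hl, hh, zero_def, lo.injEq, hi.injEq, reduceCtorEq] at h ⊢ <;> omega

theorem le_ll {a b c d : ℕ} : AlgLE (lo a b) (lo c d) ↔ a ≤ c ∧ b ≤ d := by
  constructor
  · rintro ⟨⟨s, t⟩ | ⟨s, t⟩, h⟩ <;>
      simp only [ll, lh, lo.injEq, reduceCtorEq] at h
    omega
  · rintro h
    exact ⟨lo (c - a) (d - b), by simp only [ll, lo.injEq, true_and, and_true]; omega⟩

theorem le_lh (a b n : ℕ) (k : ℤ) : AlgLE (lo a b) (hi n k) :=
  ⟨hi n (k - a - b), by simp only [lh, hi.injEq, true_and, and_true]; omega⟩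

theorem not_le_hl (a b n : ℕ) (k : ℤ) : ¬ AlgLE (hi n k) (lo a b) := by
  rintro ⟨⟨s, t⟩ | ⟨s, t⟩, h⟩ <;> simp only [hl, hh, reduceCtorEq] at h

theorem le_hh {n m : ℕ} {k l : ℤ} :
    AlgLE (hi n k) (hi m l) ↔ n < m ∨ (n = m ∧ k ≤ l) := by
  constructor
  · rintro ⟨⟨s, t⟩ | ⟨s, t⟩, h⟩ <;> simp only [hl, hh, hi.injEq] at h <;> omega
  · rintro (h | h)
    · exact ⟨hi (m - n - 1) (l - k), by simp only [hh, hi.injEq, true_and, and_true]; omega⟩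
    · exact ⟨lo (l - k).toNat 0, by simp only [hl, hi.injEq, true_and, and_true]; omega⟩

theorem unperforated : IsUnperforated MbModel := by
  rintro m x y hm h
  obtain ⟨m, rfl⟩ : ∃ j, m = j + 1 := ⟨m - 1, by omega⟩
  rcases x with ⟨a, b⟩ | ⟨n, k⟩ <;> rcases y with ⟨c, d⟩ | ⟨p, l⟩
  · rw [nsmul_lo, nsmul_lo, le_ll] at h
    rw [le_ll]
    exact ⟨Nat.le_of_mul_le_mul_left h.1 hm, Nat.le_of_mul_le_mul_left h.2 hm⟩
  · exact le_lh _ _ _ _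
  · rw [nsmul_lo, nsmul_hi] at h
    exact absurd h (not_le_hl _ _ _ _)
  · rw [nsmul_hi, nsmul_hi, le_hh] at h
    rw [le_hh]
    rcases h with h | ⟨h, h2⟩
    · left
      exact Nat.lt_of_mul_lt_mul_left (a := m + 1) (by omega)
    · right
      refine ⟨Nat.eq_of_mul_eq_mul_left hm (by omega), ?_⟩
      exact le_of_mul_le_mul_left h2 (by positivity)

theorem not_archimedean : ¬ IsArchimedeanMon MbModel := by
  intro h
  obtain ⟨u, hu⟩ := h (lo 1 0) (hi 0 0) (fun n _ => by rw [nsmul_lo]; exact le_lh _ _ _ _)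
  have h1 := u.add_neg
  rw [hu] at h1
  have := (conical _ _ h1).1
  simp [zero_def] at this

/-- One descent step. -/
theorem step {N : Type} [AddCommMonoid N] (hN : IsRefinementAddMonoid N) (g : N →+ MbModel)
    (n : ℕ) (a b c : N) (h : a + b = a + c) (ha : g a = hi 0 (-n)) (hb : g b = lo 1 0)
    (hc : g c = lo 0 1) :
    ∃ a' b' c', a' + b' = a' + c' ∧ g a' = hi 0 (-(n + 1 : ℕ)) ∧ g b' = lo 1 0 ∧
      g c' = lo 0 1 := by
  obtain ⟨z1, z2, z3, z4, h1, h2, h3, h4⟩ := hN _ _ _ _ h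
  refine ⟨z1, z3, z2, by rw [← h1, ← h3], ?_⟩
  have e1 := congrArg g h1
  have e2 := congrArg g h2
  have e3 := congrArg g h3
  have e4 := congrArg g h4
  rw [map_add] at e1 e2 e3 e4
  rw [ha] at e1 e3
  rw [hb] at e2
  rw [hc] at e4
  generalize g z1 = w1 at *
  generalize g z2 = w2 at *
  generalize g z3 = w3 at *
  generalize g z4 = w4 at *
  rcases w1 with ⟨a1, b1⟩ | ⟨a1, b1⟩ <;> rcases w2 with ⟨a2, b2⟩ | ⟨a2, b2⟩ <;>
  rcases w3 with ⟨a3, b3⟩ | ⟨a3, b3⟩ <;> rcases w4 with ⟨a4, b4⟩ | ⟨a4, b4⟩ <;>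
    simp only [ll, lh, hl, hh, lo.injEq, hi.injEq, reduceCtorEq] at e1 e2 e3 e4 ⊢
  omega

theorem no_factor {N : Type} [AddCommMonoid N] (hN : IsRefinementAddMonoid N)
    (hfg : AddMonoid.FG N) (g : N →+ MbModel) (a b c : N) (h : a + b = a + c)
    (ha : g a = hi 0 0) (hb : g b = lo 1 0) (hc : g c = lo 0 1) : False := by
  have key : ∀ n : ℕ, ∃ a b c, a + b = a + c ∧ g a = hi 0 (-n) ∧ g b = lo 1 0 ∧
      g c = lo 0 1 := by
    intro n
    induction n with
    | zero => exact ⟨a, b, c, h, by simpa using ha, hb, hc⟩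
    | succ n ih =>
      obtain ⟨a, b, c, h, ha, hb, hc⟩ := ih
      exact step hN g n a b c h ha hb hc
  choose s _ _ _ hs _ _ using key
  obtain ⟨T, hT⟩ := (AddMonoid.fg_def.1 hfg)
  have hrep : ∀ x : N, ∃ v : T → ℕ, x = ∑ t, v t • (t : N) := by
    intro x
    have hx : x ∈ AddSubmonoid.closure (T : Set N) := by rw [hT]; trivial
    induction hx using AddSubmonoid.closure_induction with
    | mem y hy =>
      classical
      refine ⟨Pi.single ⟨y, hy⟩ 1, ?_⟩
      rw [Finset.sum_eq_single ⟨y, hy⟩]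
      · simp
      · intro t _ ht
        simp [Pi.single_eq_of_ne ht]
      · simp
    | zero => exact ⟨0, by simp⟩
    | add y z _ _ hy hz =>
      obtain ⟨v, rfl⟩ := hy
      obtain ⟨w, rfl⟩ := hz
      exact ⟨v + w, by simp [add_nsmul, Finset.sum_add_distrib]⟩
  choose v hv using fun n => hrep (s n)
  obtain ⟨m, n, hmn, hle⟩ := wellQuasiOrdered_le v
  have e : s m + ∑ t, (v n t - v m t) • (t : N) = s n := by
    rw [hv m, hv n, ← Finset.sum_add_distrib]
    refine Finset.sum_congr rfl fun t _ => ?_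
    rw [← add_nsmul, Nat.add_sub_cancel' (hle t)]
  have e2 := congrArg g e
  rw [map_add, hs, hs] at e2
  have := le_hh.1 ⟨_, e2⟩
  omega

end MbModel

open MbModel

/-- Images of the generators in the model. -/
def mbGen : FreeGenMb → MbModel
  | Sum.inl l => hi 0 (-l)
  | Sum.inr 0 => lo 1 0
  | Sum.inr 1 => lo 0 1

/-- The map from the free monoid. -/
noncomputable def mbFree : FreeMonMb →+ MbModel :=
  Finsupp.liftAddHom fun i => (multiplesHom MbModel (mbGen i))

theorem mbFree_X (l : ℕ) : mbFree (Xbg l) = hi 0 (-l) := by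
  simp [mbFree, Xbg, mbGen]
theorem mbFree_Y : mbFree Ybg = lo 1 0 := by
  simp [mbFree, Ybg, mbGen]
theorem mbFree_Z : mbFree Zbg = lo 0 1 := by
  simp [mbFree, Zbg, mbGen]

theorem mbCon_le : MbCon ≤ AddCon.ker mbFree := by
  refine AddCon.addConGen_le.2 ?_
  rintro u v (⟨rfl, rfl⟩ | ⟨l, rfl, rfl⟩ | ⟨l, rfl, rfl⟩) <;>
    simp [AddCon.ker_rel, mbFree_X, mbFree_Y, mbFree_Z, hl]

/-- The comparison map. -/
noncomputable def mbPhi : MonMb →+ MbModel := AddCon.lift MbCon mbFree mbCon_le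

/-- Classes of generators. -/
noncomputable def xq (l : ℕ) : MonMb := MbCon.mk' (Xbg l)
/-- Class of y. -/
noncomputable def yq : MonMb := MbCon.mk' Ybg
/-- Class of z. -/
noncomputable def zq : MonMb := MbCon.mk' Zbg

theorem mbPhi_x (l : ℕ) : mbPhi (xq l) = hi 0 (-l) := mbFree_X l
theorem mbPhi_y : mbPhi yq = lo 1 0 := mbFree_Y
theorem mbPhi_z : mbPhi zq = lo 0 1 := mbFree_Z

theorem rel0 : xq 0 + yq = xq 0 + zq :=
  (AddCon.eq MbCon).2 (AddConGen.Rel.of _ _ (Or.inl ⟨rfl, rfl⟩))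
theorem rel_y (l : ℕ) : xq l = xq (l + 1) + yq :=
  (AddCon.eq MbCon).2 (AddConGen.Rel.of _ _ (Or.inr (Or.inl ⟨l, rfl, rfl⟩)))
theorem rel_z (l : ℕ) : xq l = xq (l + 1) + zq :=
  (AddCon.eq MbCon).2 (AddConGen.Rel.of _ _ (Or.inr (Or.inr ⟨l, rfl, rfl⟩)))

/-- `x_0 + k y` for integer `k`. -/
noncomputable def xi : ℤ → MonMb
  | Int.ofNat k => xq 0 + k • yq
  | Int.negSucc k => xq (k + 1)

theorem xi_y (k : ℤ) : xi k + yq = xi (k + 1) := by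
  rcases k with k | _ | k
  · change xq 0 + k • yq + yq = xq 0 + (k + 1) • yq
    rw [succ_nsmul, add_assoc]
  · change xq 1 + yq = xq 0 + 0 • yq
    rw [zero_nsmul, add_zero, ← rel_y]
  · change xq (k + 2) + yq = xq (k + 1)
    rw [← rel_y]

theorem xi_z (k : ℤ) : xi k + zq = xi (k + 1) := by
  rw [← xi_y]
  rcases k with k | k
  · change xq 0 + k • yq + zq = xq 0 + k • yq + yq
    rw [add_right_comm, ← rel0, add_right_comm]
  · change xq (k + 1) + zq = xq (k + 1) + yq
    rw [← rel_y, ← rel_z]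

theorem xi_ny (k : ℤ) (n : ℕ) : xi k + n • yq = xi (k + n) := by
  induction n with
  | zero => simp
  | succ n ih => rw [succ_nsmul, ← add_assoc, ih, xi_y]; push_cast; rw [add_assoc]

theorem xi_nz (k : ℤ) (n : ℕ) : xi k + n • zq = xi (k + n) := by
  induction n with
  | zero => simp
  | succ n ih => rw [succ_nsmul, ← add_assoc, ih, xi_z]; push_cast; rw [add_assoc]

theorem xi_xi (k l : ℤ) : xi k + xi l = xi 0 + xi (k + l) := by
  have aux : ∀ (p q : ℤ) (n : ℕ), xi (p + n) + xi q = xi p + xi (q + n) := by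
    intro p q n
    rw [← xi_ny, ← xi_ny]; abel
  rcases le_total 0 k with h | h
  · obtain ⟨n, rfl⟩ := Int.eq_ofNat_of_zero_le h
    have := aux 0 l n
    rw [zero_add] at this
    rw [this, add_comm l]
  · obtain ⟨n, hn⟩ := Int.eq_ofNat_of_zero_le (a := -k) (by omega)
    have := aux k (k + l) n
    rw [show k + (n : ℤ) = 0 by omega, show k + l + (n : ℤ) = l by omega] at this
    exact this.symm

/-- The inverse. -/
noncomputable def mbSigmaFun : MbModel → MonMb
  | lo a b => a • yq + b • zq
  | hi n k => n • xi 0 + xi k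

/-- The inverse as a homomorphism. -/
noncomputable def mbSigma : MbModel →+ MonMb where
  toFun := mbSigmaFun
  map_zero' := by simp [zero_def, mbSigmaFun]
  map_add' := by
    have hlo : ∀ (n : ℕ) (k : ℤ) (a b : ℕ),
        n • xi 0 + xi (k + a + b) = n • xi 0 + xi k + (a • yq + b • zq) := by
      intro n k a b
      rw [← xi_nz, ← xi_ny]; abel
    rintro (⟨a, b⟩ | ⟨n, k⟩) (⟨c, d⟩ | ⟨m, l⟩)
    · simp only [ll, mbSigmaFun, add_nsmul]; abel
    · simp only [lh, mbSigmaFun, hlo]; abel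
    · simp only [hl, mbSigmaFun, hlo]
    · simp only [hh, mbSigmaFun]
      rw [add_nsmul, add_nsmul, one_nsmul, add_assoc _ (xi 0), ← xi_xi]; abel

theorem xi_neg (l : ℕ) : xi (-l) = xq l := by
  rcases l with _ | l
  · change xq 0 + 0 • yq = xq 0
    simp
  · rfl

theorem mbSigma_phi (x : MonMb) : mbSigma (mbPhi x) = x := by
  have : (mbSigma.comp mbPhi).comp MbCon.mk' = MbCon.mk' := by
    refine Finsupp.addHom_ext' fun i => ?_
    ext
    rcases i with l | i
    · change mbSigma (mbPhi (xq l)) = xq l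
      rw [mbPhi_x]
      change 0 • xi 0 + xi (-l) = xq l
      rw [xi_neg]; simp
    · fin_cases i
      · change mbSigma (mbPhi yq) = yq
        rw [mbPhi_y]
        change 1 • yq + 0 • zq = yq
        simp
      · change mbSigma (mbPhi zq) = zq
        rw [mbPhi_z]
        change 0 • yq + 1 • zq = zq
        simp
  obtain ⟨x, rfl⟩ := AddCon.mk'_surjective x
  exact DFunLike.congr_fun this x

theorem mbPhi_xi (k : ℤ) : mbPhi (xi k) = hi 0 k := by
  rcases k with k | k
  · change mbPhi (xq 0 + k • yq) = _
    simp [mbPhi_x, mbPhi_y, nsmul_lo, hl]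
  · change mbPhi (xq (k + 1)) = _
    rw [mbPhi_x]; rfl

theorem mbPhi_sigma (x : MbModel) : mbPhi (mbSigma x) = x := by
  rcases x with ⟨a, b⟩ | ⟨n, k⟩
  · change mbPhi (a • yq + b • zq) = _
    simp [mbPhi_y, mbPhi_z, nsmul_lo, ll]
  · change mbPhi (n • xi 0 + xi k) = _
    rw [map_add, map_nsmul, mbPhi_xi, mbPhi_xi]
    rcases n with _ | n
    · simp
    · rw [nsmul_hi, hh]; simp

theorem mbPhi_inj {x y : MonMb} (h : mbPhi x = mbPhi y) : x = y := by
  rw [← mbSigma_phi x, h, mbSigma_phi]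

theorem mbPhi_le {x y : MonMb} : AlgLE x y ↔ AlgLE (mbPhi x) (mbPhi y) := by
  constructor
  · rintro ⟨z, rfl⟩
    exact ⟨mbPhi z, (map_add _ _ _).symm⟩
  · rintro ⟨z, hz⟩
    refine ⟨mbSigma z, mbPhi_inj ?_⟩
    rw [map_add, mbPhi_sigma, hz]

theorem mb_not_tame : ¬ IsTame MonMb := by
  intro h
  obtain ⟨N, fg, href, f, g, hfac⟩ := h (AddSubmonoid.closure {xq 0, yq, zq})
    ((AddSubmonoid.fg_iff _).2 ⟨_, rfl, by simp⟩)
  let X : AddSubmonoid.closure {xq 0, yq, zq} :=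
    ⟨xq 0, AddSubmonoid.subset_closure (by simp)⟩
  let Y : AddSubmonoid.closure {xq 0, yq, zq} :=
    ⟨yq, AddSubmonoid.subset_closure (by simp)⟩
  let Z : AddSubmonoid.closure {xq 0, yq, zq} :=
    ⟨zq, AddSubmonoid.subset_closure (by simp)⟩
  have e : X + Y = X + Z := Subtype.ext rel0
  refine no_factor href fg (mbPhi.comp g) (f X) (f Y) (f Z) ?_ ?_ ?_ ?_
  · rw [← map_add, e, map_add]
  · change mbPhi (g (f X)) = _
    rw [hfac]; exact mbPhi_x 0
  · change mbPhi (g (f Y)) = _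
    rw [hfac]; exact mbPhi_y
  · change mbPhi (g (f Z)) = _
    rw [hfac]; exact mbPhi_z

/-- The monoid `M̄` is a wild refinement monoid; it is conical, stably finite,
antisymmetric, separative, and unperforated, but not archimedean. -/
theorem MonMb_wild_and_properties :
    IsRefinementAddMonoid MonMb ∧ ¬ IsTame MonMb ∧
    IsConical MonMb ∧ IsStablyFinite MonMb ∧ IsAntisymmetricMon MonMb ∧
    IsSeparative MonMb ∧ IsUnperforated MonMb ∧ ¬ IsArchimedeanMon MonMb := by
  refine ⟨?_, mb_not_tame, ?_, ?_, ?_, ?_, ?_, ?_⟩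
  · intro x1 x2 y1 y2 h
    have h' := congrArg mbPhi h
    rw [map_add, map_add] at h'
    obtain ⟨a, b, c, d, h1, h2, h3, h4⟩ := MbModel.refinement _ _ _ _ h'
    refine ⟨mbSigma a, mbSigma b, mbSigma c, mbSigma d, ?_, ?_, ?_, ?_⟩ <;>
      apply mbPhi_inj <;> rw [map_add, mbPhi_sigma, mbPhi_sigma] <;> assumption
  · intro x y h
    have h' := congrArg mbPhi h
    rw [map_add, map_zero] at h'
    have := MbModel.conical _ _ h'
    exact ⟨mbPhi_inj (by rw [this.1, map_zero]), mbPhi_inj (by rw [this.2, map_zero])⟩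
  · intro x y h
    have h' := congrArg mbPhi h
    rw [map_add] at h'
    exact mbPhi_inj (by rw [MbModel.stablyFinite _ _ h', map_zero])
  · intro x y h1 h2
    exact mbPhi_inj (MbModel.antisymm _ _ (mbPhi_le.1 h1) (mbPhi_le.1 h2))
  · intro x y h1 h2
    have h1' := congrArg mbPhi h1
    have h2' := congrArg mbPhi h2
    simp only [map_add] at h1' h2'
    exact mbPhi_inj (MbModel.separative _ _ h1' h2')
  · intro m x y hm h
    rw [mbPhi_le, map_nsmul, map_nsmul] at h
    exact mbPhi_le.2 (MbModel.unperforated m _ _ hm h)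
  · intro h
    apply MbModel.not_archimedean
    intro x y hxy
    have := h (mbSigma x) (mbSigma y) (fun n hn => by
      rw [mbPhi_le, map_nsmul, mbPhi_sigma, mbPhi_sigma]; exact hxy n hn)
    have h2 := this.map mbPhi
    rwa [mbPhi_sigma] at h2
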